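/- For every integer ν ≥ 2 and every real t > 0, the ν-th derivative of the Riemann–Siegel theta function satisfies |θ^{(ν)}(t)| ≤ (ν−2)!/(2·t^{ν−1}) + 2·ν!/(√ν·t^ν). -/

import Mathlib

noncomputable def RSTheta (t : ℝ) : ℝ :=
  -(t / 2) * Real.log Real.pi +
    (1 / 2) * ∫ u in (0:ℝ)..t,
      (deriv Complex.Gamma (1 / 4 + (u / 2) * Complex.I) /
        Complex.Gamma (1 / 4 + (u / 2) * Complex.I)).re

open Filter Topology

noncomputable def lgT (j : ℕ) (z : ℂ) : ℂ :=
  z * ((Real.log (j + 2) - Real.log (j + 1) : ℝ) : ℂ) -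
    (Complex.log (z + (j + 1)) - ((Real.log (j + 1) : ℝ) : ℂ))

noncomputable def lgT' (j : ℕ) (z : ℂ) : ℂ :=
  ((Real.log (j + 2) - Real.log (j + 1) : ℝ) : ℂ) - (z + (j + 1))⁻¹

lemma re_add_pos {z : ℂ} (hz : 0 < z.re) (j : ℕ) : 0 < (z + (j + 1)).re := by
  simp; positivity

lemma lgT_hasDerivAt (j : ℕ) {z : ℂ} (hz : 0 < z.re) : HasDerivAt (lgT j) (lgT' j z) z := by
  unfold lgT lgT'
  have h1 : HasDerivAt (fun z : ℂ => z + ((j : ℂ) + 1)) 1 z := (hasDerivAt_id z).add_const _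
  have h2 := h1.clog (Or.inl (re_add_pos hz j))
  have h3 := ((hasDerivAt_id z).mul_const
    (((Real.log (j + 2) - Real.log (j + 1) : ℝ) : ℂ))).sub (h2.sub_const (((Real.log (j + 1) : ℝ) : ℂ)))
  refine h3.congr_deriv ?_
  simp

lemma norm_ge {z : ℂ} (hz : 0 < z.re) (j : ℕ) : (j + 1 : ℝ) ≤ ‖z + (j + 1)‖ := by
  have := Complex.re_le_norm (z + (j + 1))
  simp at this
  linarith

lemma lgT'_bound (j : ℕ) {z : ℂ} {R : ℝ} (hz : 0 < z.re) (hR : ‖z‖ ≤ R) :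
    ‖lgT' j z‖ ≤ (1 + R) * (1 / ((j : ℝ) + 1) ^ 2) := by
  have hj : (0 : ℝ) < (j : ℝ) + 1 := by positivity
  have hn := norm_ge hz j
  have hne : z + ((j : ℂ) + 1) ≠ 0 := by
    rw [← norm_pos_iff]; linarith
  have hne' : ((j : ℂ) + 1) ≠ 0 := by exact_mod_cast hj.ne'
  have e : lgT' j z = ((Real.log (j + 2) - Real.log (j + 1) - 1 / (j + 1) : ℝ) : ℂ)
      + z / ((j + 1) * (z + (j + 1))) := by
    unfold lgT'; push_cast; field_simp; ring
  rw [e]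
  have hlog : Real.log (j + 2) - Real.log (j + 1) = Real.log (((j : ℝ) + 2) / (j + 1)) := by
    rw [Real.log_div] <;> positivity
  have l1 : Real.log (((j : ℝ) + 2) / (j + 1)) ≤ 1 / (j + 1) := by
    have := Real.log_le_sub_one_of_pos (x := ((j : ℝ) + 2) / (j + 1)) (by positivity)
    refine this.trans (le_of_eq ?_); field_simp; ring
  have l2 : 1 / ((j : ℝ) + 2) ≤ Real.log (((j : ℝ) + 2) / (j + 1)) := by
    have := Real.one_sub_inv_le_log_of_pos (x := ((j : ℝ) + 2) / (j + 1)) (by positivity)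
    refine (le_of_eq ?_).trans this; field_simp; ring
  have l3 : 1 / ((j : ℝ) + 1) - 1 / (j + 2) ≤ 1 / ((j : ℝ) + 1) ^ 2 := by
    rw [div_sub_div _ _ (by positivity) (by positivity), div_le_div_iff₀ (by positivity) (by positivity)]
    nlinarith
  have b1 : ‖((Real.log (j + 2) - Real.log (j + 1) - 1 / (j + 1) : ℝ) : ℂ)‖ ≤ 1 / ((j : ℝ) + 1) ^ 2 := by
    rw [Complex.norm_real, Real.norm_eq_abs, hlog, abs_le]
    have : (0:ℝ) ≤ 1 / ((j : ℝ) + 1) ^ 2 := by positivity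
    constructor <;> linarith
  have b2 : ‖z / ((j + 1) * (z + (j + 1)))‖ ≤ R * (1 / ((j : ℝ) + 1) ^ 2) := by
    have : ‖((j : ℂ) + 1)‖ = (j : ℝ) + 1 := by
      rw [show ((j : ℂ) + 1) = (((j : ℝ) + 1 : ℝ) : ℂ) by push_cast; rfl, Complex.norm_real]
      exact abs_of_pos hj
    rw [norm_div, norm_mul, this, ← mul_one_div, sq]
    gcongr
    exact (norm_nonneg z).trans hR
  calc _ ≤ _ := norm_add_le _ _
    _ ≤ _ := add_le_add b1 b2
    _ = _ := by ring

lemma summ_sq : Summable (fun j : ℕ => 1 / ((j : ℝ) + 1) ^ 2) := by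
  have := (summable_nat_add_iff 1).2 (Real.summable_one_div_nat_pow.2 (one_lt_two))
  simpa using this

def halfR (R : ℝ) : Set ℂ := {z | 0 < z.re} ∩ Metric.ball 0 R

lemma halfR_open (R : ℝ) : IsOpen (halfR R) :=
  (isOpen_lt continuous_const Complex.continuous_re).inter Metric.isOpen_ball

lemma halfR_conn (R : ℝ) : IsPreconnected (halfR R) :=
  ((convex_halfSpace_re_gt 0).inter (convex_ball _ _)).isPreconnected

lemma lgT_one (j : ℕ) : lgT j 1 = 0 := by
  unfold lgT
  have : (1 : ℂ) + (j + 1) = (((j : ℝ) + 2 : ℝ) : ℂ) := by push_cast; ring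
  rw [this, ← Complex.ofReal_log (by positivity)]
  push_cast; ring

lemma mem_halfR {z : ℂ} (hz : 0 < z.re) : z ∈ halfR (‖z‖ + 2) := ⟨hz, by simp⟩
lemma one_mem_halfR (z : ℂ) : (1 : ℂ) ∈ halfR (‖z‖ + 2) :=
  ⟨by simp, by simp; linarith [norm_nonneg z]⟩

lemma lgT_summable {z : ℂ} (hz : 0 < z.re) : Summable (fun j => lgT j z) :=
  summable_of_summable_hasDerivAt_of_isPreconnected (g' := lgT')
    (summ_sq.mul_left (1 + (‖z‖ + 2))) (halfR_open (‖z‖ + 2)) (halfR_conn _)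
    (fun n y hy => lgT_hasDerivAt n hy.1)
    (fun n y hy => lgT'_bound n hy.1 (by simpa using (Metric.mem_ball.1 hy.2).le))
    (one_mem_halfR z) (by simp [lgT_one, summable_zero]) (mem_halfR hz)

lemma lgT_tsum_deriv {z : ℂ} (hz : 0 < z.re) :
    HasDerivAt (fun z => ∑' j, lgT j z) (∑' j, lgT' j z) z :=
  hasDerivAt_tsum_of_isPreconnected (g' := lgT')
    (summ_sq.mul_left (1 + (‖z‖ + 2))) (halfR_open (‖z‖ + 2)) (halfR_conn _)
    (fun n y hy => lgT_hasDerivAt n hy.1)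
    (fun n y hy => lgT'_bound n hy.1 (by simpa using (Metric.mem_ball.1 hy.2).le))
    (one_mem_halfR z) (by simp [lgT_one, summable_zero]) (mem_halfR hz)

lemma exp_partial {z : ℂ} (hz : 0 < z.re) (n : ℕ) :
    Complex.exp (∑ j ∈ Finset.range n, lgT j z) =
      ((n + 1 : ℕ) : ℂ) ^ z * (n.factorial : ℂ) / ∏ j ∈ Finset.range n, (z + (j + 1)) := by
  induction n with
  | zero => simp
  | succ n ih =>
    rw [Finset.sum_range_succ, Complex.exp_add, ih, Finset.prod_range_succ, lgT]
    have hne : z + ((n : ℂ) + 1) ≠ 0 := by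
      intro h; have := re_add_pos hz n; rw [h] at this; simp at this
    rw [Complex.exp_sub, Complex.exp_sub, Complex.exp_log hne, ← Complex.ofReal_exp (Real.log _),
      Real.exp_log (by positivity)]
    have c1 : ((n + 1 : ℕ) : ℂ) ≠ 0 := by exact_mod_cast Nat.succ_ne_zero n
    have c2 : ((n + 1 + 1 : ℕ) : ℂ) ≠ 0 := by exact_mod_cast Nat.succ_ne_zero (n + 1)
    rw [Complex.cpow_def_of_ne_zero c1, Complex.cpow_def_of_ne_zero c2]
    have g1 : Complex.log ((n + 1 : ℕ) : ℂ) = ((Real.log ((n : ℝ) + 1) : ℝ) : ℂ) := by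
      rw [Complex.ofReal_log (by positivity)]; push_cast; rfl
    have g2 : Complex.log ((n + 1 + 1 : ℕ) : ℂ) = ((Real.log ((n : ℝ) + 2) : ℝ) : ℂ) := by
      rw [Complex.ofReal_log (by positivity)]; push_cast; congr 1; ring
    rw [g1, g2]
    have : Complex.exp (((Real.log ((n : ℝ) + 2) : ℝ) : ℂ) * z) =
        Complex.exp (((Real.log ((n : ℝ) + 1) : ℝ) : ℂ) * z) *
        Complex.exp (z * ((Real.log (n + 2) - Real.log (n + 1) : ℝ) : ℂ)) := by
      rw [← Complex.exp_add]; congr 1; push_cast; ring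
    rw [this, Nat.factorial_succ]
    push_cast
    simp only [div_eq_mul_inv, mul_inv, inv_inv]
    ring

lemma gamma_eq {z : ℂ} (hz : 0 < z.re) :
    Complex.Gamma z = Complex.exp (∑' j, lgT j z) / z := by
  have hz0 : z ≠ 0 := by intro h; rw [h] at hz; simp at hz
  have h1 := (Complex.GammaSeq_tendsto_Gamma z).comp (tendsto_add_atTop_nat 1)
  refine tendsto_nhds_unique h1 ?_
  have h2 := (Complex.continuous_exp.tendsto _).comp (lgT_summable hz).hasSum.tendsto_sum_nat
  have h3 : Tendsto (fun n : ℕ => ((n + 1 : ℕ) : ℂ) / (z + ((n + 1 : ℕ) : ℂ))) atTop (𝓝 1) := by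
    have a := (tendsto_inv_atTop_nhds_zero_nat (𝕜 := ℂ)).comp (tendsto_add_atTop_nat 1)
    have b : Tendsto (fun n : ℕ => (z * (((n + 1 : ℕ) : ℂ))⁻¹ + 1)⁻¹) atTop (𝓝 1) := by
      have := ((a.const_mul z).add_const 1).inv₀ (by simp)
      simpa using this
    refine b.congr fun n => ?_
    have c1 : ((n + 1 : ℕ) : ℂ) ≠ 0 := by exact_mod_cast Nat.succ_ne_zero n
    rw [← inv_div]; congr 1
    field_simp
  have h4 := (h2.div_const z).mul h3
  rw [mul_one] at h4
  refine h4.congr fun n => ?_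
  simp only [Function.comp]
  rw [exp_partial hz, Complex.GammaSeq, Finset.prod_range_succ, Finset.prod_range_succ',
    Nat.factorial_succ]
  push_cast
  simp only [div_eq_mul_inv, mul_inv, add_zero]
  ring

noncomputable def psi (z : ℂ) : ℂ := deriv Complex.Gamma z / Complex.Gamma z

lemma psi_eq {z : ℂ} (hz : 0 < z.re) : psi z = ∑' j, lgT' j z - z⁻¹ := by
  have hz0 : z ≠ 0 := by intro h; rw [h] at hz; simp at hz
  have hev : Complex.Gamma =ᶠ[𝓝 z] fun z => Complex.exp (∑' j, lgT j z) / z := by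
    filter_upwards [(isOpen_lt continuous_const Complex.continuous_re).mem_nhds hz] with y hy
    exact gamma_eq hy
  have hd := ((lgT_tsum_deriv hz).cexp.div (hasDerivAt_id z) hz0).congr_of_eventuallyEq hev
  rw [psi, hd.deriv, gamma_eq hz]
  have := Complex.exp_ne_zero (∑' j, lgT j z)
  simp only [id]
  field_simp

noncomputable def TT (k : ℕ) (z : ℂ) : ℂ := ∑' n : ℕ, ((z + n) ^ k)⁻¹

lemma norm_lower {z : ℂ} (hz : 1 / 8 < z.re) (n : ℕ) : ((n : ℝ) + 1) / 8 ≤ ‖z + n‖ := by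
  have := Complex.re_le_norm (z + n)
  simp at this
  have : (0 : ℝ) ≤ n := by positivity
  linarith

lemma TT_bound {z : ℂ} (hz : 1 / 8 < z.re) {k : ℕ} (hk : 2 ≤ k) (n : ℕ) :
    ‖((z + n) ^ k)⁻¹‖ ≤ 8 ^ k * (1 / ((n : ℝ) + 1) ^ 2) := by
  have h := norm_lower hz n
  have hn : (1 : ℝ) ≤ (n : ℝ) + 1 := by linarith [(Nat.cast_nonneg n : (0 : ℝ) ≤ n)]
  rw [norm_inv, norm_pow]
  calc (‖z + n‖ ^ k)⁻¹ ≤ ((((n : ℝ) + 1) / 8) ^ k)⁻¹ := by gcongr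
    _ = 8 ^ k * (1 / ((n : ℝ) + 1) ^ k) := by rw [div_pow]; field_simp
    _ ≤ _ := by gcongr

lemma TT_summable {z : ℂ} (hz : 1 / 8 < z.re) {k : ℕ} (hk : 2 ≤ k) :
    Summable (fun n : ℕ => ((z + n) ^ k)⁻¹) :=
  .of_norm_bounded (summ_sq.mul_left (8 ^ k)) (TT_bound hz hk)

lemma ne_of_re {z : ℂ} (hz : 0 < z.re) (n : ℕ) : z + n ≠ 0 := by
  intro h
  have h' : (z + n).re = 0 := by rw [h]; rfl
  simp at h'
  linarith [(Nat.cast_nonneg n : (0 : ℝ) ≤ n)]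

lemma invpow_deriv (k : ℕ) {z : ℂ} (hz : 0 < z.re) (n : ℕ) :
    HasDerivAt (fun z : ℂ => ((z + n) ^ k)⁻¹) (-(k : ℂ) * ((z + n) ^ (k + 1))⁻¹) z := by
  have h := ne_of_re hz n
  have h1 := (((hasDerivAt_id z).add_const (n : ℂ)).pow k).inv (pow_ne_zero k h)
  refine h1.congr_deriv ?_
  simp only [id, mul_one]
  rcases k with _ | k
  · simp
  · simp only [Nat.add_sub_cancel]
    have : (z + n) ^ k ≠ 0 := pow_ne_zero k h
    simp only [pow_succ, Pi.pow_apply]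
    field_simp

lemma TT_deriv {z : ℂ} (hz : 1 / 8 < z.re) {k : ℕ} (hk : 2 ≤ k) :
    HasDerivAt (TT k) (-(k : ℂ) * TT (k + 1) z) z := by
  have hb : ∀ (n : ℕ) (y : ℂ), y ∈ {z : ℂ | 1 / 8 < z.re} →
      ‖-(k : ℂ) * ((y + n) ^ (k + 1))⁻¹‖ ≤ (k : ℝ) * (8 ^ (k + 1) * (1 / ((n : ℝ) + 1) ^ 2)) := by
    intro n y hy
    rw [norm_mul, norm_neg, Complex.norm_natCast]
    exact mul_le_mul_of_nonneg_left (TT_bound hy (by omega) n) (Nat.cast_nonneg k)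
  have hd : ∀ (n : ℕ) (y : ℂ), y ∈ {z : ℂ | 1 / 8 < z.re} →
      HasDerivAt (fun z : ℂ => ((z + n) ^ k)⁻¹) (-(k : ℂ) * ((y + n) ^ (k + 1))⁻¹) y := by
    intro n y hy
    exact invpow_deriv k (lt_trans (by norm_num) hy) n
  have key := hasDerivAt_tsum_of_isPreconnected (t := {z : ℂ | 1 / 8 < z.re})
    (g := fun (n : ℕ) (z : ℂ) => ((z + n) ^ k)⁻¹)
    (g' := fun (n : ℕ) (z : ℂ) => -(k : ℂ) * ((z + n) ^ (k + 1))⁻¹)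
    ((summ_sq.mul_left (8 ^ (k + 1))).mul_left (k : ℝ))
    (isOpen_lt continuous_const Complex.continuous_re)
    (convex_halfSpace_re_gt _).isPreconnected
    hd hb (y₀ := z) hz (TT_summable hz hk) hz
  rw [tsum_mul_left] at key
  exact key

lemma psi_deriv {z : ℂ} (hz : 1 / 8 < z.re) : HasDerivAt psi (TT 2 z) z := by
  have hz' : 0 < z.re := lt_trans (by norm_num) hz
  have hz0 : z ≠ 0 := by intro h; rw [h] at hz'; simp at hz'
  have hev : psi =ᶠ[𝓝 z] fun z => ∑' j, lgT' j z - z⁻¹ := by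
    filter_upwards [(isOpen_lt continuous_const Complex.continuous_re).mem_nhds hz'] with y hy
    exact psi_eq hy
  have hs : HasDerivAt (fun z => ∑' j, lgT' j z) (∑' j : ℕ, ((z + ((j + 1 : ℕ) : ℂ)) ^ 2)⁻¹) z := by
    refine hasDerivAt_tsum_of_isPreconnected (t := {z : ℂ | 0 < z.re})
      (g' := fun j z => ((z + ((j + 1 : ℕ) : ℂ)) ^ 2)⁻¹) summ_sq
      (isOpen_lt continuous_const Complex.continuous_re)
      (convex_halfSpace_re_gt _).isPreconnected (fun n y hy => ?_) (fun n y hy => ?_)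
      (y₀ := z) hz' ?_ hz'
    · have := (invpow_deriv 1 hy (n + 1)).const_sub
        ((Real.log (n + 2) - Real.log (n + 1) : ℝ) : ℂ)
      unfold lgT'
      simpa using this
    · have := norm_ge hy n
      rw [norm_inv, norm_pow, one_div]
      push_cast
      gcongr
    · exact .of_norm_bounded (summ_sq.mul_left (1 + ‖z‖)) (fun j => lgT'_bound j hz' le_rfl)
  refine ((hs.sub (hasDerivAt_inv hz0)).congr_of_eventuallyEq hev).congr_deriv ?_
  rw [TT, (TT_summable hz le_rfl).tsum_eq_zero_add]
  simp
  ring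


noncomputable def ff (k : ℕ) (t x : ℝ) : ℂ := (((x : ℂ) + t * Complex.I) ^ k)⁻¹

lemma base_ne {t : ℝ} (ht : 0 < t) (x : ℝ) : (x : ℂ) + t * Complex.I ≠ 0 := by
  intro h
  have := congrArg Complex.im h
  simp at this
  linarith

lemma base_norm_sq (t x : ℝ) : ‖(x : ℂ) + t * Complex.I‖ ^ 2 = x ^ 2 + t ^ 2 := by
  rw [Complex.sq_norm, Complex.normSq_add_mul_I]

lemma ff_deriv {t : ℝ} (ht : 0 < t) (k : ℕ) (x : ℝ) :
    HasDerivAt (ff k t) (-(k : ℂ) * ff (k + 1) t x) x := by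
  have h := base_ne ht x
  have h0 : HasDerivAt (fun z : ℂ => z + t * Complex.I) 1 (x : ℂ) := (hasDerivAt_id _).add_const _
  have h1 := ((h0.pow k).inv (pow_ne_zero k h)).comp_ofReal
  refine h1.congr_deriv ?_
  unfold ff
  simp only [mul_one]
  rcases k with _ | k
  · simp
  · simp only [Nat.add_sub_cancel]
    have : ((x : ℂ) + t * Complex.I) ^ k ≠ 0 := pow_ne_zero k h
    simp only [pow_succ, Pi.pow_apply]
    field_simp

noncomputable def HH (ν : ℕ) (t x : ℝ) : ℝ :=
  ν / t ^ (ν + 1) * (x / √(1 + (ν + 1) / (3 * t ^ 2) * x ^ 2))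

lemma HH_deriv {t : ℝ} (ht : 0 < t) (ν : ℕ) (x : ℝ) :
    HasDerivAt (HH ν t)
      (ν / t ^ (ν + 1) * (1 / √(1 + (ν + 1) / (3 * t ^ 2) * x ^ 2) ^ 3)) x := by
  unfold HH
  refine HasDerivAt.const_mul _ ?_
  set b : ℝ := (ν + 1) / (3 * t ^ 2) with hb
  have hbp : 0 < b := by positivity
  have hp : 0 < 1 + b * x ^ 2 := by positivity
  have hs := Real.sqrt_pos.2 hp
  have h1 : HasDerivAt (fun x : ℝ => 1 + b * x ^ 2) (b * (2 * x)) x := by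
    simpa using ((hasDerivAt_pow 2 x).const_mul b).const_add 1
  have h2 := (hasDerivAt_id x).div (h1.sqrt hp.ne') hs.ne'
  refine h2.congr_deriv ?_
  have hsq := Real.sq_sqrt hp.le
  simp only [id]
  field_simp
  rw [hsq]
  ring

lemma bern (ν : ℕ) (hν : 2 ≤ ν) (y : ℝ) (hy : 0 ≤ y) :
    (1 + (ν + 1) / 3 * y) ^ 3 ≤ (1 + y) ^ (ν + 1) := by
  have hν' : (2 : ℝ) ≤ ν := by exact_mod_cast hν
  have h := one_add_mul_self_le_rpow_one_add (s := y) (by linarith) (p := ((ν : ℝ) + 1) / 3)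
    (by linarith)
  calc (1 + (ν + 1) / 3 * y) ^ 3 ≤ ((1 + y) ^ (((ν : ℝ) + 1) / 3)) ^ 3 := by gcongr
    _ = (1 + y) ^ (ν + 1) := by
      rw [← Real.rpow_natCast, ← Real.rpow_mul (by linarith), ← Real.rpow_natCast]
      congr 1; push_cast; ring

lemma ff_bound {t : ℝ} (ht : 0 < t) (ν : ℕ) (hν : 2 ≤ ν) (x : ℝ) :
    ‖-(ν : ℂ) * ff (ν + 1) t x‖ ≤
      ν / t ^ (ν + 1) * (1 / √(1 + (ν + 1) / (3 * t ^ 2) * x ^ 2) ^ 3) := by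
  have hp : 0 < 1 + (ν + 1) / (3 * t ^ 2) * x ^ 2 := by positivity
  have hs := Real.sqrt_pos.2 hp
  have hsq := Real.sq_sqrt hp.le
  have key : t ^ (ν + 1) * √(1 + (ν + 1) / (3 * t ^ 2) * x ^ 2) ^ 3 ≤
      ‖(x : ℂ) + t * Complex.I‖ ^ (ν + 1) := by
    refine le_of_sq_le_sq ?_ (by positivity)
    rw [mul_pow, pow_right_comm t, pow_right_comm (√_), hsq, pow_right_comm ‖_‖, base_norm_sq]
    have e : x ^ 2 + t ^ 2 = t ^ 2 * (1 + x ^ 2 / t ^ 2) := by field_simp; ring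
    rw [e, mul_pow]
    gcongr
    refine le_trans (le_of_eq ?_) (bern ν hν (x ^ 2 / t ^ 2) (by positivity))
    congr 1; field_simp
  rw [norm_mul, norm_neg, Complex.norm_natCast, ff, norm_inv, norm_pow, div_mul_div_comm, mul_one,
    ← div_eq_mul_inv]
  gcongr

lemma ff_diff {t : ℝ} (ht : 0 < t) (ν : ℕ) (hν : 2 ≤ ν) {a b : ℝ} (hab : a ≤ b) :
    ‖ff ν t b - ff ν t a‖ ≤ HH ν t b - HH ν t a := by
  refine image_norm_le_of_norm_deriv_right_le_deriv_boundary (a := a) (b := b)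
    (f := fun x => ff ν t x - ff ν t a) (B := fun x => HH ν t x - HH ν t a)
    (fun x _ => ((ff_deriv ht ν x).sub_const _).continuousAt.continuousWithinAt)
    (fun x _ => ((ff_deriv ht ν x).sub_const _).hasDerivWithinAt) (by simp)
    (fun x => (HH_deriv ht ν x).sub_const _) (fun x _ => ff_bound ht ν hν x)
    (Set.right_mem_Icc.2 hab)

lemma step {t : ℝ} (ht : 0 < t) (m : ℕ) (a : ℝ) :
    ‖ff (m + 2) t a - (1 / 2) * ((m + 1 : ℂ)⁻¹ * ff (m + 1) t a
      - (m + 1 : ℂ)⁻¹ * ff (m + 1) t (a + 2))‖ ≤ HH (m + 2) t (a + 2) - HH (m + 2) t a := by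
  have hm : (m + 1 : ℂ) ≠ 0 := by exact_mod_cast Nat.succ_ne_zero m
  have hd : ∀ x : ℝ, HasDerivAt (fun x : ℝ => (x : ℂ) * ff (m + 2) t a +
      (m + 1 : ℂ)⁻¹ * ff (m + 1) t x) (ff (m + 2) t a - ff (m + 2) t x) x := by
    intro x
    have h1 : HasDerivAt (fun x : ℝ => (x : ℂ)) 1 x := Complex.ofRealCLM.hasDerivAt
    refine ((h1.mul_const (ff (m + 2) t a)).add
      ((ff_deriv ht (m + 1) x).const_mul (m + 1 : ℂ)⁻¹)).congr_deriv ?_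
    push_cast
    field_simp
    ring
  have h := norm_image_sub_le_of_norm_deriv_le_segment' (a := a) (b := a + 2)
    (C := HH (m + 2) t (a + 2) - HH (m + 2) t a)
    (fun x _ => (hd x).hasDerivWithinAt) (fun x hx => ?_) (a + 2) (Set.right_mem_Icc.2 (by linarith))
  · have e : ff (m + 2) t a - (1 / 2) * ((m + 1 : ℂ)⁻¹ * ff (m + 1) t a
      - (m + 1 : ℂ)⁻¹ * ff (m + 1) t (a + 2)) = (1 / 2) * ((((a + 2 : ℝ) : ℂ) * ff (m + 2) t a +
      (m + 1 : ℂ)⁻¹ * ff (m + 1) t (a + 2)) - ((a : ℂ) * ff (m + 2) t a +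
      (m + 1 : ℂ)⁻¹ * ff (m + 1) t a)) := by push_cast; ring
    rw [e, norm_mul]
    have : ‖(1 / 2 : ℂ)‖ = 1 / 2 := by simp
    rw [this]
    linarith
  · rw [norm_sub_rev]
    have h1 := ff_diff ht (m + 2) (by omega) hx.1
    have h2 := (norm_nonneg _).trans (ff_diff ht (m + 2) (by omega) hx.2.le)
    linarith

lemma HH_nonneg {t : ℝ} (ht : 0 < t) (ν : ℕ) {x : ℝ} (hx : 0 ≤ x) : 0 ≤ HH ν t x := by
  unfold HH; positivity

lemma HH_le {t : ℝ} (ht : 0 < t) (ν : ℕ) (hν : 2 ≤ ν) (x : ℝ) :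
    HH ν t x ≤ 2 * ν / (√ν * t ^ ν) := by
  have hν' : (2 : ℝ) ≤ ν := by exact_mod_cast hν
  have hp : 0 < 1 + (ν + 1) / (3 * t ^ 2) * x ^ 2 := by positivity
  have hs := Real.sqrt_pos.2 hp
  have hsq := Real.sq_sqrt hp.le
  have hn : 0 < √(ν : ℝ) := Real.sqrt_pos.2 (by linarith)
  have h : x / √(1 + (ν + 1) / (3 * t ^ 2) * x ^ 2) ≤ 2 * t / √ν := by
    rw [div_le_div_iff₀ hs hn]
    refine le_of_sq_le_sq ?_ (by positivity)
    rw [mul_pow, mul_pow, mul_pow, hsq, Real.sq_sqrt (by linarith)]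
    have : 2 ^ 2 * t ^ 2 * (1 + (ν + 1) / (3 * t ^ 2) * x ^ 2) = 4 * t ^ 2 + 4 / 3 * (ν + 1) * x ^ 2 := by
      field_simp; ring
    rw [this]
    nlinarith [sq_nonneg x, sq_nonneg t]
  calc HH ν t x ≤ ν / t ^ (ν + 1) * (2 * t / √ν) := by unfold HH; gcongr
    _ = _ := by rw [pow_succ]; field_simp

lemma partial_bound {t : ℝ} (ht : 0 < t) (m : ℕ) (N : ℕ) :
    ‖∑ n ∈ Finset.range N, ff (m + 2) t (2 * n + 1 / 2) - (1 / 2) * ((m + 1 : ℂ)⁻¹ * ff (m + 1) t (1 / 2)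
      - (m + 1 : ℂ)⁻¹ * ff (m + 1) t (2 * N + 1 / 2))‖ ≤
      HH (m + 2) t (2 * N + 1 / 2) - HH (m + 2) t (1 / 2) := by
  induction N with
  | zero => simp
  | succ N ih =>
    have h := step ht m (2 * N + 1 / 2)
    have e : (2 * (N : ℝ) + 1 / 2) + 2 = 2 * ((N + 1 : ℕ) : ℝ) + 1 / 2 := by push_cast; ring
    rw [e] at h
    rw [Finset.sum_range_succ]
    have := norm_add_le_of_le ih h
    refine le_trans (le_of_eq ?_) (this.trans (le_of_eq ?_))
    · congr 1; ring
    · ring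

lemma base_norm_ge_t {t : ℝ} (_ht : 0 < t) (x : ℝ) : t ≤ ‖(x : ℂ) + t * Complex.I‖ := by
  refine le_of_sq_le_sq ?_ (norm_nonneg _)
  rw [base_norm_sq]; nlinarith [sq_nonneg x]

lemma base_norm_ge_x (t : ℝ) (x : ℝ) : x ≤ ‖(x : ℂ) + t * Complex.I‖ := by
  refine le_of_sq_le_sq ?_ (norm_nonneg _)
  rw [base_norm_sq]; nlinarith [sq_nonneg t]

lemma norm_m (m : ℕ) : ‖(m + 1 : ℂ)⁻¹‖ = ((m : ℝ) + 1)⁻¹ := by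
  rw [norm_inv]
  have : ((m : ℂ) + 1) = ((m + 1 : ℕ) : ℂ) := by push_cast; rfl
  rw [this, Complex.norm_natCast]; push_cast; rfl

lemma main_bound {t : ℝ} (ht : 0 < t) (m : ℕ)
    (hsum : Summable fun n : ℕ => ff (m + 2) t (2 * n + 1 / 2)) :
    ‖∑' n : ℕ, ff (m + 2) t (2 * n + 1 / 2)‖ ≤
      1 / (2 * (m + 1) * t ^ (m + 1)) +
        2 * ((m + 2 : ℕ) : ℝ) / (√((m + 2 : ℕ) : ℝ) * t ^ (m + 2)) := by
  set A : ℝ := 1 / (2 * (m + 1) * t ^ (m + 1)) +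
        2 * ((m + 2 : ℕ) : ℝ) / (√((m + 2 : ℕ) : ℝ) * t ^ (m + 2)) with hA
  have h1 := (hsum.hasSum.tendsto_sum_nat.comp (tendsto_add_atTop_nat 1)).norm
  have h2 : Tendsto (fun N : ℕ => A + 1 / ((N : ℝ) + 1)) atTop (𝓝 A) := by
    simpa using (tendsto_one_div_add_atTop_nhds_zero_nat (𝕜 := ℝ)).const_add A
  refine le_of_tendsto_of_tendsto' h1 h2 fun N => ?_
  simp only [Function.comp]
  have hp := partial_bound ht m (N + 1)
  have hH := HH_le ht (m + 2) (by omega) (2 * ((N + 1 : ℕ) : ℝ) + 1 / 2)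
  have hH0 := HH_nonneg ht (m + 2) (x := 1 / 2) (by norm_num)
  have q1 : ‖(m + 1 : ℂ)⁻¹ * ff (m + 1) t (1 / 2)‖ ≤ 1 / ((m + 1) * t ^ (m + 1)) := by
    rw [norm_mul, norm_m, ff, norm_inv, norm_pow, one_div ((_ : ℝ) * _), mul_inv]
    gcongr
    exact base_norm_ge_t ht _
  have q2 : ‖(m + 1 : ℂ)⁻¹ * ff (m + 1) t (2 * ((N + 1 : ℕ) : ℝ) + 1 / 2)‖ ≤ 1 / ((N : ℝ) + 1) := by
    rw [norm_mul, norm_m, ff, norm_inv, norm_pow, one_div ((N : ℝ) + 1)]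
    set y := ‖((2 * ((N + 1 : ℕ) : ℝ) + 1 / 2 : ℝ) : ℂ) + t * Complex.I‖ with hy
    have hyx : 2 * ((N + 1 : ℕ) : ℝ) + 1 / 2 ≤ y := base_norm_ge_x t _
    push_cast at hyx
    have hN : (0 : ℝ) ≤ N := Nat.cast_nonneg N
    have hm : (0 : ℝ) ≤ m := Nat.cast_nonneg m
    have hy1 : 1 ≤ y := by linarith
    rw [← mul_inv]
    have : y ≤ y ^ (m + 1) := le_self_pow₀ hy1 (by omega)
    refine inv_anti₀ (by positivity) ?_
    nlinarith
  have tri : ∀ S P Q : ℂ, ‖S‖ ≤ ‖S - (1 / 2) * (P - Q)‖ + (1 / 2) * ‖P‖ + (1 / 2) * ‖Q‖ := by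
    intro S P Q
    have e : S = (S - (1 / 2) * (P - Q)) + (1 / 2) * P - (1 / 2) * Q := by ring
    have hh : ‖(1 / 2 : ℂ)‖ = 1 / 2 := by simp
    calc ‖S‖ = ‖(S - (1 / 2) * (P - Q)) + (1 / 2) * P - (1 / 2) * Q‖ := by rw [← e]
      _ ≤ ‖(S - (1 / 2) * (P - Q)) + (1 / 2) * P‖ + ‖(1 / 2) * Q‖ := norm_sub_le _ _
      _ ≤ ‖(S - (1 / 2) * (P - Q))‖ + ‖(1 / 2) * P‖ + ‖(1 / 2) * Q‖ := by gcongr; exact norm_add_le _ _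
      _ = _ := by rw [norm_mul, norm_mul, hh]
  have := tri _ _ _ |>.trans (add_le_add_three hp (mul_le_mul_of_nonneg_left q1 (by norm_num : (0:ℝ) ≤ 1/2))
    (mul_le_mul_of_nonneg_left q2 (by norm_num : (0:ℝ) ≤ 1/2)))
  have e1 : 1 / (2 * ((m : ℝ) + 1) * t ^ (m + 1)) = 1 / 2 * (1 / (((m : ℝ) + 1) * t ^ (m + 1))) := by
    field_simp
  have e2 : (0 : ℝ) ≤ 1 / ((N : ℝ) + 1) := by positivity
  rw [hA, e1]
  linarith

noncomputable def ww (z : ℂ) : ℂ := 1 / 4 + z / 2 * Complex.I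

lemma ww_re (u : ℝ) : (1 / 8 : ℝ) < (ww u).re := by
  have : (ww u).re = 1 / 4 := by
    have : ww u = ((1 / 4 : ℝ) : ℂ) + ((u / 2 : ℝ) : ℂ) * Complex.I := by unfold ww; push_cast; rfl
    rw [this]; simp
  rw [this]; norm_num

lemma comp_ww {F : ℂ → ℂ} {F' : ℂ} {u : ℝ} (c : ℂ) (hF : HasDerivAt F F' (ww u)) :
    HasDerivAt (fun u : ℝ => (c * F (ww u)).re) (c * (Complex.I / 2) * F').re u := by
  have h0 : HasDerivAt ww (1 / 2 * Complex.I) (u : ℂ) :=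
    (((hasDerivAt_id (u : ℂ)).div_const 2).mul_const Complex.I).const_add (1 / 4)
  have h1 := ((hF.comp (u : ℂ) h0).const_mul c).real_of_complex
  refine h1.congr_deriv ?_
  congr 1; ring

lemma theta_deriv (t : ℝ) :
    HasDerivAt RSTheta (-(1 / 2) * Real.log Real.pi + ((1 / 2 : ℂ) * psi (ww t)).re) t := by
  have hc : Continuous fun u : ℝ => (psi (ww u)).re := by
    rw [continuous_iff_continuousAt]
    intro u
    have := (comp_ww 1 (psi_deriv (ww_re u))).continuousAt
    simpa using this
  have h1 := (hc.integral_hasStrictDerivAt 0 t).hasDerivAt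
  have h2 := (((hasDerivAt_id t).div_const 2).neg.mul_const (Real.log Real.pi)).add
    (h1.const_mul (1 / 2))
  have e : RSTheta = fun t : ℝ => -(t / 2) * Real.log Real.pi +
      (1 / 2) * ∫ u in (0:ℝ)..t, (psi (ww u)).re := by
    funext t
    simp only [RSTheta, psi, ww]
  rw [e]
  refine HasDerivAt.congr_deriv (f := fun t : ℝ => -(t / 2) * Real.log Real.pi +
      (1 / 2) * ∫ u in (0:ℝ)..t, (psi (ww u)).re) h2 ?_
  have : ((1 / 2 : ℂ) * psi (ww t)).re = 1 / 2 * (psi (ww t)).re := by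
    rw [show (1 / 2 : ℂ) = ((1 / 2 : ℝ) : ℂ) by push_cast; rfl, Complex.re_ofReal_mul]
  rw [this]

lemma theta_iter (m : ℕ) : ∃ c : ℂ, ‖c‖ = ((m + 1).factorial : ℝ) / 2 ^ (m + 2) ∧
    iteratedDeriv (m + 2) RSTheta = fun u : ℝ => (c * TT (m + 2) (ww u)).re := by
  induction m with
  | zero =>
    refine ⟨1 / 2 * (Complex.I / 2), by simp; norm_num, ?_⟩
    have e1 : iteratedDeriv 1 RSTheta =
        fun t : ℝ => -(1 / 2) * Real.log Real.pi + ((1 / 2 : ℂ) * psi (ww t)).re := by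
      rw [iteratedDeriv_one]; funext t; exact (theta_deriv t).deriv
    rw [iteratedDeriv_succ, e1]
    funext u
    exact ((comp_ww (1 / 2) (psi_deriv (ww_re u))).const_add _).deriv
  | succ m ih =>
    obtain ⟨c, hc, h⟩ := ih
    refine ⟨c * (Complex.I / 2) * (-((m + 2 : ℕ) : ℂ)), ?_, ?_⟩
    · rw [norm_mul, norm_mul, hc, norm_neg, Complex.norm_natCast, norm_div, Complex.norm_I,
        Nat.factorial_succ (m + 1)]
      simp only [Complex.norm_ofNat]
      push_cast
      field_simp
      ring
    · rw [iteratedDeriv_succ, h]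
      funext u
      rw [(comp_ww c (TT_deriv (ww_re u) (by omega : 2 ≤ m + 2))).deriv]
      congr 1; ring

theorem stmt11 (ν : ℕ) (hν : 2 ≤ ν) (t : ℝ) (ht : 0 < t) :
    |iteratedDeriv ν RSTheta t| ≤
      ((ν - 2).factorial : ℝ) / (2 * t ^ (ν - 1)) +
        2 * (ν.factorial : ℝ) / (Real.sqrt ν * t ^ ν) := by
  obtain ⟨m, rfl⟩ : ∃ m, ν = m + 2 := ⟨ν - 2, by omega⟩
  obtain ⟨c, hc, h⟩ := theta_iter m
  have he : ∀ n : ℕ, ((ww t + n) ^ (m + 2))⁻¹ = 2 ^ (m + 2) * ff (m + 2) t (2 * n + 1 / 2) := by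
    intro n
    have : ((2 * n + 1 / 2 : ℝ) : ℂ) + t * Complex.I = 2 * (ww t + n) := by
      unfold ww; push_cast; ring
    rw [ff, this, mul_pow, mul_inv, ← mul_assoc, mul_inv_cancel₀ (pow_ne_zero _ two_ne_zero), one_mul]
  have hs := TT_summable (ww_re t) (by omega : 2 ≤ m + 2)
  simp_rw [he] at hs
  have h2 : (2 : ℂ) ^ (m + 2) ≠ 0 := pow_ne_zero _ two_ne_zero
  have hs' := (summable_mul_left_iff h2).1 hs
  have hb := main_bound ht m hs'
  have hT : ‖TT (m + 2) (ww t)‖ = 2 ^ (m + 2) * ‖∑' n : ℕ, ff (m + 2) t (2 * n + 1 / 2)‖ := by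
    unfold TT
    simp_rw [he]
    rw [tsum_mul_left, norm_mul, norm_pow, Complex.norm_ofNat]
  rw [h]
  calc |(c * TT (m + 2) (ww t)).re| ≤ ‖c * TT (m + 2) (ww t)‖ := Complex.abs_re_le_norm _
    _ = ((m + 1).factorial : ℝ) * ‖∑' n : ℕ, ff (m + 2) t (2 * n + 1 / 2)‖ := by
      rw [norm_mul, hc, hT]; field_simp
    _ ≤ ((m + 1).factorial : ℝ) * (1 / (2 * (m + 1) * t ^ (m + 1)) +
        2 * ((m + 2 : ℕ) : ℝ) / (√((m + 2 : ℕ) : ℝ) * t ^ (m + 2))) := by gcongr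
    _ = _ := by
      rw [Nat.factorial_succ (m + 1), mul_add]
      congr 1
      · rw [Nat.factorial_succ, show m + 2 - 2 = m by omega, show m + 2 - 1 = m + 1 by omega]
        push_cast
        field_simp
      · push_cast; ring
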